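/- arXiv:2406.18466 — 3 statements merged into one kernel-verified Lean document; each statement's English description precedes it below -/
import Mathlib

section
/- Let μ be a distribution on Q_d and let k be even with 2 ≤ k ≤ d. If there exists X ∈ Q_d with |X| = k and P1(X,𝟎) > 1/2, then there exists a coordinate i with x_i = 1 such that w_i^0 < 3/4 − 1/(2k). -/
open Finset

/-- Hamming distance on the hypercube `{0,1}^d` (modelled as `Fin d → Bool`). -/
def hamming {d : ℕ} (X Y : Fin d → Bool) : ℕ :=
  (Finset.univ.filter (fun i => X i ≠ Y i)).card

/-- Number of 1-coordinates of a point of the hypercube. -/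
def nOnes {d : ℕ} (X : Fin d → Bool) : ℕ :=
  (Finset.univ.filter (fun i => X i = true)).card

/-- `μ` is a probability distribution on the hypercube. -/
def IsDistribution {d : ℕ} (μ : (Fin d → Bool) → ℝ) : Prop :=
  (∀ X, 0 ≤ μ X) ∧ ∑ X : Fin d → Bool, μ X = 1

open Classical in
/-- The weight of a set of points under `μ`. -/
noncomputable def wt {d : ℕ} (μ : (Fin d → Bool) → ℝ) (S : Set (Fin d → Bool)) : ℝ :=
  ∑ X : Fin d → Bool, if X ∈ S then μ X else 0

/-- Payoff to player 1, positioned at `A`, against player 2 positioned at `B`. -/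
noncomputable def P1 {d : ℕ} (μ : (Fin d → Bool) → ℝ) (A B : Fin d → Bool) : ℝ :=
  wt μ {X | hamming X A < hamming X B} + (1/2) * wt μ {X | hamming X A = hamming X B}

/-- Payoff to player 2, positioned at `B`, against player 1 positioned at `A`. -/
noncomputable def P2 {d : ℕ} (μ : (Fin d → Bool) → ℝ) (A B : Fin d → Bool) : ℝ :=
  wt μ {X | hamming X B < hamming X A} + (1/2) * wt μ {X | hamming X A = hamming X B}

/-- `(A,B)` is an equilibrium: neither player can strictly improve by moving. -/
def IsEquilibrium {d : ℕ} (μ : (Fin d → Bool) → ℝ) (A B : Fin d → Bool) : Prop :=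
  (∀ A', P1 μ A' B ≤ P1 μ A B) ∧ (∀ B', P2 μ A B' ≤ P2 μ A B)

/-- `w_i^0`: the weight of the subcube where coordinate `i` equals 0. -/
noncomputable def w0 {d : ℕ} (μ : (Fin d → Bool) → ℝ) (i : Fin d) : ℝ :=
  wt μ {X | X i = false}

/-- The all-zeros point `𝟎`. -/
def zeroPt (d : ℕ) : Fin d → Bool := fun _ => false

/-- The all-ones point `𝟏`. -/
def onePt (d : ℕ) : Fin d → Bool := fun _ => true

/-- Number of coordinates in the support of `X` at which `Z` vanishes. -/
def zerosOn {d : ℕ} (X Z : Fin d → Bool) : ℕ :=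
  (Finset.univ.filter (fun i => X i = true ∧ Z i = false)).card

lemma wt_setOf {d : ℕ} (μ : (Fin d → Bool) → ℝ) (p : (Fin d → Bool) → Prop)
    [DecidablePred p] : wt μ {X | p X} = ∑ X, if p X then μ X else 0 := by
  unfold wt
  congr!

lemma zerosOn_le_nOnes {d : ℕ} (X Z : Fin d → Bool) : zerosOn X Z ≤ nOnes X :=
  Finset.card_le_card (Finset.monotone_filter_right _ fun _ _ h => h.1)

lemma hamming_add_nOnes {d : ℕ} (X Z : Fin d → Bool) :
    hamming Z X + nOnes X = hamming Z (zeroPt d) + 2 * zerosOn X Z := by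
  simp only [hamming, nOnes, zerosOn, Finset.card_filter, Finset.mul_sum]
  rw [← Finset.sum_add_distrib, ← Finset.sum_add_distrib]
  refine Finset.sum_congr rfl fun i _ => ?_
  cases hx : X i <;> cases hz : Z i <;> simp [zeroPt]

/-- The weights of the 0-subcubes over the support of `X` add up to the expectation of
`zerosOn X`. -/
lemma sum_w0_eq_sum_mul_zerosOn {d : ℕ} (μ : (Fin d → Bool) → ℝ) (X : Fin d → Bool) :
    ∑ i ∈ Finset.univ.filter (fun i => X i = true), w0 μ i = ∑ Z, μ Z * zerosOn X Z := by
  simp only [w0, wt_setOf]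
  rw [Finset.sum_comm]
  refine Finset.sum_congr rfl fun Z _ => ?_
  rw [← Finset.sum_filter, Finset.filter_filter, Finset.sum_const, nsmul_eq_mul, mul_comm]
  rfl

/-- The expected number of zeros on the support of a point with `2 * m` ones is bounded
in terms of its payoff against `𝟎`. -/
lemma sum_mul_zerosOn_le {d m : ℕ} (hm : 1 ≤ m) {μ : (Fin d → Bool) → ℝ}
    (hμ : IsDistribution μ) {X : Fin d → Bool} (hX : nOnes X = 2 * m) :
    ∑ Z, μ Z * zerosOn X Z ≤ 2 * m - (m + 1) * P1 μ X (zeroPt d) := by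
  have key : ∀ Z, μ Z * zerosOn X Z ≤ 2 * m * μ Z - (m + 1) *
      ((if hamming Z X < hamming Z (zeroPt d) then μ Z else 0) +
        1 / 2 * (if hamming Z X = hamming Z (zeroPt d) then μ Z else 0)) := by
    intro Z
    have h0 := hμ.1 Z
    have h1 := hamming_add_nOnes X Z
    have h2 := zerosOn_le_nOnes X Z
    have hm' : (1 : ℝ) ≤ m := by exact_mod_cast hm
    rw [hX] at h1 h2
    rcases lt_trichotomy (hamming Z X) (hamming Z (zeroPt d)) with h | h | h
    · have hz : (zerosOn X Z : ℝ) + 1 ≤ m := by exact_mod_cast (by omega : zerosOn X Z + 1 ≤ m)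
      rw [if_pos h, if_neg h.ne]
      nlinarith
    · have hz : (zerosOn X Z : ℝ) = m := by exact_mod_cast (by omega : zerosOn X Z = m)
      rw [if_neg h.not_lt, if_pos h, hz]
      nlinarith
    · have hz : (zerosOn X Z : ℝ) ≤ 2 * m := by exact_mod_cast h2
      rw [if_neg h.not_gt, if_neg h.ne']
      nlinarith
  calc ∑ Z, μ Z * zerosOn X Z ≤ _ := Finset.sum_le_sum fun Z _ => key Z
    _ = 2 * m - (m + 1) * P1 μ X (zeroPt d) := by
      rw [Finset.sum_sub_distrib, ← Finset.mul_sum, ← Finset.mul_sum, hμ.2,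
        Finset.sum_add_distrib, ← Finset.mul_sum, mul_one]
      rw [P1, wt_setOf, wt_setOf]

theorem statement_3 (d k : ℕ) (hk : Even k) (hk1 : 2 ≤ k) (hkd : k ≤ d)
    (μ : (Fin d → Bool) → ℝ) (hμ : IsDistribution μ)
    (X : Fin d → Bool) (hX : nOnes X = k) (hP : (1:ℝ)/2 < P1 μ X (zeroPt d)) :
    ∃ i : Fin d, X i = true ∧ w0 μ i < (3:ℝ)/4 - 1/(2*k) := by
  obtain ⟨m, rfl⟩ := hk
  have hm : 1 ≤ m := by omega
  have hm' : (1 : ℝ) ≤ m := by exact_mod_cast hm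
  by_contra! hall
  have hlow : ((m + m : ℕ) : ℝ) * ((3 : ℝ) / 4 - 1 / (2 * ((m + m : ℕ) : ℝ))) ≤
      ∑ i ∈ Finset.univ.filter (fun i => X i = true), w0 μ i := by
    rw [← nsmul_eq_mul, ← hX]
    exact Finset.card_nsmul_le_sum _ _ _ fun i hi => hX ▸ hall i (Finset.mem_filter.1 hi).2
  have hupp := sum_mul_zerosOn_le hm hμ (hX.trans (two_mul m).symm)
  rw [sum_w0_eq_sum_mul_zerosOn] at hlow
  have hval : ((m + m : ℕ) : ℝ) * ((3 : ℝ) / 4 - 1 / (2 * ((m + m : ℕ) : ℝ))) =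
      (3 * m - 1) / 2 := by
    push_cast
    field_simp
    ring
  nlinarith
end

section
/- Let 1 ≤ k ≤ d and let μ be a distribution on Q_d with w_i^0 ≥ 3/4 − 1/(4k) for all i ∈ {1,...,d}. Then (𝟎,𝟎) is a k-local equilibrium for the two-player Voronoi game on Q_d with distribution μ. -/
open Finset

/-- `(A,B)` is a `k`-local equilibrium: neither player can strictly improve their payoff
by moving to a point within distance `k` of their current position. -/
def IsLocalEquilibrium {d : ℕ} (k : ℕ) (μ : (Fin d → Bool) → ℝ) (A B : Fin d → Bool) : Prop :=
  (∀ A', hamming A A' ≤ k → P1 μ A' B ≤ P1 μ A B) ∧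
  (∀ B', hamming B B' ≤ k → P2 μ A B' ≤ P2 μ A B)

/-- Number of coordinates where both points are equal to 1. -/
def commonOnes {d : ℕ} (A X : Fin d → Bool) : ℕ :=
  (Finset.univ.filter (fun i => A i = true ∧ X i = true)).card

lemma hamming_add_two_mul_commonOnes {d : ℕ} (A X : Fin d → Bool) :
    hamming X A + 2 * commonOnes A X = hamming X (zeroPt d) + nOnes A := by
  unfold hamming commonOnes nOnes zeroPt
  rw [Finset.card_filter, Finset.card_filter, Finset.card_filter, Finset.card_filter,
    Finset.mul_sum, ← Finset.sum_add_distrib, ← Finset.sum_add_distrib]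
  refine Finset.sum_congr rfl fun i _ => ?_
  cases A i <;> cases X i <;> simp

lemma hamming_zeroPt_left {d : ℕ} (A : Fin d → Bool) : hamming (zeroPt d) A = nOnes A := by
  simp only [hamming, nOnes, zeroPt]
  congr 1
  ext i
  cases A i <;> simp

lemma sum_mul_commonOnes {d : ℕ} {μ : (Fin d → Bool) → ℝ} (hμ : IsDistribution μ)
    (A : Fin d → Bool) :
    ∑ X, μ X * (commonOnes A X : ℝ) = ∑ i with A i = true, (1 - w0 μ i) := by
  have h : ∀ i, 1 - w0 μ i = ∑ X, if X i = true then μ X else 0 := fun i => by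
    rw [← hμ.2, w0, wt, ← Finset.sum_sub_distrib]
    refine Finset.sum_congr rfl fun X _ => ?_
    cases hX : X i <;> simp [hX]
  simp_rw [h]
  rw [Finset.sum_comm]
  refine Finset.sum_congr rfl fun X _ => ?_
  rw [← Finset.sum_filter, Finset.filter_filter, Finset.sum_const, nsmul_eq_mul, mul_comm]
  rfl

lemma P1_self {d : ℕ} {μ : (Fin d → Bool) → ℝ} (hμ : IsDistribution μ) (A : Fin d → Bool) :
    P1 μ A A = 1 / 2 := by
  simp [P1, wt, hμ.2]

lemma P2_eq_P1 {d : ℕ} (μ : (Fin d → Bool) → ℝ) (A B : Fin d → Bool) :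
    P2 μ A B = P1 μ B A := by
  simp only [P1, P2, eq_comm]

/-- Markov-type bound on the payoff of a point other than the origin against the origin. -/
lemma P1_zeroPt_le {d : ℕ} {μ : (Fin d → Bool) → ℝ} (hμ : IsDistribution μ)
    (A : Fin d → Bool) (hA : 1 ≤ nOnes A) :
    P1 μ A (zeroPt d) ≤ 2 / ((nOnes A : ℝ) + 1) * ∑ X, μ X * (commonOnes A X : ℝ) := by
  rw [P1, wt, wt, Finset.mul_sum, Finset.mul_sum, ← Finset.sum_add_distrib]
  refine Finset.sum_le_sum fun X _ => ?_
  have h := hamming_add_two_mul_commonOnes A X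
  have hX := hμ.1 X
  have hm : (1 : ℝ) ≤ nOnes A := by exact_mod_cast hA
  have ht : (0 : ℝ) ≤ commonOnes A X := Nat.cast_nonneg _
  have key : ∀ c : ℝ, c * (nOnes A + 1) ≤ 2 * commonOnes A X →
      c * μ X ≤ 2 / ((nOnes A : ℝ) + 1) * (μ X * commonOnes A X) := fun c hc => by
    have : c ≤ 2 * commonOnes A X / ((nOnes A : ℝ) + 1) := (le_div_iff₀ (by linarith)).2 hc
    calc c * μ X ≤ 2 * commonOnes A X / ((nOnes A : ℝ) + 1) * μ X :=
          mul_le_mul_of_nonneg_right this hX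
      _ = _ := by ring
  rcases lt_trichotomy (hamming X A) (hamming X (zeroPt d)) with hlt | heq | hgt
  · have h1 : (nOnes A : ℝ) + 1 ≤ 2 * commonOnes A X := by
      exact_mod_cast (by omega : nOnes A + 1 ≤ 2 * commonOnes A X)
    simpa [hlt, hlt.ne] using key 1 (by linarith)
  · have h1 : (2 : ℝ) * commonOnes A X = nOnes A := by
      exact_mod_cast (by omega : 2 * commonOnes A X = nOnes A)
    simpa [heq] using key (1 / 2) (by linarith)
  · simpa [hgt.not_gt, hgt.ne'] using key 0 (by linarith)

lemma P1_zeroPt_le_half {d k : ℕ} (hk : 1 ≤ k) {μ : (Fin d → Bool) → ℝ}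
    (hμ : IsDistribution μ) (hw : ∀ i, (3:ℝ)/4 - 1/(4*k) ≤ w0 μ i)
    (A : Fin d → Bool) (hA : hamming (zeroPt d) A ≤ k) : P1 μ A (zeroPt d) ≤ 1 / 2 := by
  rw [hamming_zeroPt_left] at hA
  rcases Nat.eq_zero_or_pos (nOnes A) with h0 | hpos
  · have : A = zeroPt d := by
      ext i
      simpa [nOnes, zeroPt, Finset.filter_eq_empty_iff] using
        Finset.filter_eq_empty_iff.1 (Finset.card_eq_zero.1 h0) (Finset.mem_univ i)
    rw [this, P1_self hμ]
  · have hk' : (1 : ℝ) ≤ k := by exact_mod_cast hk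
    have hm : (1 : ℝ) ≤ nOnes A := by exact_mod_cast hpos
    have hmk : (nOnes A : ℝ) ≤ k := by exact_mod_cast hA
    have hsum : ∑ X, μ X * (commonOnes A X : ℝ) ≤ nOnes A * (1 / 4 + 1 / (4 * k)) := by
      rw [sum_mul_commonOnes hμ, nOnes, ← nsmul_eq_mul]
      exact Finset.sum_le_card_nsmul _ _ _ fun i _ => by linarith [hw i]
    have hquarter : (nOnes A : ℝ) * (1 / 4 + 1 / (4 * k)) ≤ (nOnes A + 1) / 4 := by
      have : (nOnes A : ℝ) / k ≤ 1 := (div_le_one (by linarith)).2 hmk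
      calc (nOnes A : ℝ) * (1 / 4 + 1 / (4 * k)) = (nOnes A + nOnes A / k) / 4 := by
            field_simp
        _ ≤ _ := by linarith
    calc P1 μ A (zeroPt d)
        ≤ 2 / ((nOnes A : ℝ) + 1) * ∑ X, μ X * (commonOnes A X : ℝ) := P1_zeroPt_le hμ A hpos
      _ ≤ 2 / ((nOnes A : ℝ) + 1) * ((nOnes A + 1) / 4) := by
          gcongr
          exact hsum.trans hquarter
      _ = 1 / 2 := by
          field_simp
          norm_num

theorem statement_4 (d k : ℕ) (hk1 : 1 ≤ k) (hkd : k ≤ d)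
    (μ : (Fin d → Bool) → ℝ) (hμ : IsDistribution μ)
    (hw : ∀ i, (3:ℝ)/4 - 1/(4*k) ≤ w0 μ i) :
    IsLocalEquilibrium k μ (zeroPt d) (zeroPt d) := by
  refine ⟨fun A hA => ?_, fun B hB => ?_⟩
  · rw [P1_self hμ]
    exact P1_zeroPt_le_half hk1 hμ hw A hA
  · rw [P2_eq_P1, P2_eq_P1, P1_self hμ]
    exact P1_zeroPt_le_half hk1 hμ hw B hB
end

section
/- For any odd d ≥ 1 and any real c with 1/2 < c < 3/4 − 1/(4d), there exists a distribution μ on Q_d with w_i^0 = c for all i ∈ {1,...,d} such that the two-player Voronoi game on Q_d with distribution μ has no equilibrium. -/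
open Finset

lemma wt_nonneg {d : ℕ} {μ : (Fin d → Bool) → ℝ} (hμ : ∀ X, 0 ≤ μ X) (S : Set (Fin d → Bool)) :
    0 ≤ wt μ S := by
  unfold wt
  refine Finset.sum_nonneg fun X _ => ?_
  split_ifs
  exacts [hμ X, le_rfl]

lemma wt_mono {d : ℕ} {μ : (Fin d → Bool) → ℝ} (hμ : ∀ X, 0 ≤ μ X) {S T : Set (Fin d → Bool)}
    (h : S ⊆ T) : wt μ S ≤ wt μ T := by
  unfold wt
  refine Finset.sum_le_sum fun X _ => ?_
  by_cases hS : X ∈ S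
  · simp [hS, h hS]
  · rw [if_neg hS]
    split_ifs
    exacts [hμ X, le_rfl]

lemma wt_le_P1 {d : ℕ} {μ : (Fin d → Bool) → ℝ} (hμ : ∀ X, 0 ≤ μ X) {A B : Fin d → Bool}
    {S : Set (Fin d → Bool)} (h : ∀ X ∈ S, hamming X A < hamming X B) : wt μ S ≤ P1 μ A B := by
  have h₁ := wt_mono hμ (T := {X | hamming X A < hamming X B}) h
  have h₂ := wt_nonneg hμ {X | hamming X A = hamming X B}
  unfold P1
  linarith

lemma P1_add_P2 {d : ℕ} {μ : (Fin d → Bool) → ℝ} (hμ : ∑ X, μ X = 1) (A B : Fin d → Bool) :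
    P1 μ A B + P2 μ A B = 1 := by
  have key : wt μ {X | hamming X A < hamming X B} + wt μ {X | hamming X B < hamming X A} +
      wt μ {X | hamming X A = hamming X B} = 1 := by
    unfold wt
    rw [← hμ, ← Finset.sum_add_distrib, ← Finset.sum_add_distrib]
    refine Finset.sum_congr rfl fun X _ => ?_
    rcases lt_trichotomy (hamming X A) (hamming X B) with h | h | h
    · simp [h, h.not_gt, h.ne]
    · simp [h]
    · simp [h, h.not_gt, h.ne']
  unfold P1 P2
  linarith

lemma P2_self {d : ℕ} {μ : (Fin d → Bool) → ℝ} (hμ : ∑ X, μ X = 1) (A : Fin d → Bool) :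
    P2 μ A A = 1 / 2 := by
  have h := P1_add_P2 hμ A A
  have h' : P1 μ A A = P2 μ A A := by simp [P1, P2]
  linarith

/-- If every position can be beaten by an opponent, there is no equilibrium. -/
lemma not_isEquilibrium_of_beaten {d : ℕ} {μ : (Fin d → Bool) → ℝ} (hμ : ∑ X, μ X = 1)
    (h : ∀ B, ∃ A, 1 / 2 < P1 μ A B) (A B : Fin d → Bool) : ¬ IsEquilibrium μ A B := by
  rintro ⟨h₁, h₂⟩
  obtain ⟨A', hA'⟩ := h B
  have := h₁ A'
  have := h₂ A
  rw [P2_self hμ] at this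
  have := P1_add_P2 hμ A B
  linarith

lemma hamming_update_false_lt {d : ℕ} {X B : Fin d → Bool} {i : Fin d} (hX : X i = false)
    (hB : B i = true) : hamming X (Function.update B i false) < hamming X B := by
  unfold hamming
  refine Finset.card_lt_card (Finset.ssubset_iff_of_subset ?_ |>.2 ⟨i, ?_, ?_⟩)
  · intro j
    by_cases hj : j = i
    · subst hj; simp [hX]
    · simp [hj]
  · simp [hX, hB]
  · simp [hX]

/-- When every coordinate is biased towards `0` and `𝟎` is beaten, there is no equilibrium. -/
lemma not_isEquilibrium_of_zeroPt_beaten {d : ℕ} {μ : (Fin d → Bool) → ℝ} (hμ : IsDistribution μ)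
    (hw : ∀ i, 1 / 2 < w0 μ i) (h : ∃ A, 1 / 2 < P1 μ A (zeroPt d)) (A B : Fin d → Bool) :
    ¬ IsEquilibrium μ A B := by
  refine not_isEquilibrium_of_beaten hμ.2 (fun B => ?_) A B
  by_cases hB : ∃ i, B i = true
  · obtain ⟨i, hi⟩ := hB
    refine ⟨Function.update B i false, (hw i).trans_le (wt_le_P1 hμ.1 ?_)⟩
    exact fun X hX => hamming_update_false_lt hX hi
  · have : B = zeroPt d := by
      funext i
      simpa [zeroPt] using fun hi => hB ⟨i, hi⟩
    rwa [this]

/-- The `j`-th cyclic shift of the point of `Q_{2m+1}` whose first `m + 1` coordinates are `1`. -/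
def cyclicBlock (m : ℕ) (j : Fin (2 * m + 1)) : Fin (2 * m + 1) → Bool :=
  fun i => decide ((i - j).val ≤ m)

lemma card_filter_val_le (m : ℕ) : #{i : Fin (2 * m + 1) | i.val ≤ m} = m + 1 := by
  have h : ({i : Fin (2 * m + 1) | i.val ≤ m} : Finset _) = Finset.Iic ⟨m, by omega⟩ := by
    ext i; simp [Fin.le_def]
  rw [h, Fin.card_Iic]

lemma card_cyclicBlock_eq_true (m : ℕ) (j : Fin (2 * m + 1)) :
    #{i | cyclicBlock m j i = true} = m + 1 := by
  rw [← card_filter_val_le m]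
  exact Finset.card_equiv (Equiv.subRight j) (by simp [cyclicBlock])

lemma card_cyclicBlock_eq_false (m : ℕ) (j : Fin (2 * m + 1)) :
    #{i | cyclicBlock m j i = false} = m := by
  have h := Finset.card_filter_add_card_filter_not (s := Finset.univ)
    (fun i => cyclicBlock m j i = true)
  simp only [Bool.not_eq_true, card_cyclicBlock_eq_true, Finset.card_univ, Fintype.card_fin] at h
  omega

lemma card_shift_cyclicBlock_eq_false (m : ℕ) (i : Fin (2 * m + 1)) :
    #{j | cyclicBlock m j i = false} = m := by
  have h := Finset.card_filter_add_card_filter_not (s := Finset.univ)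
    (fun j => cyclicBlock m j i = true)
  have h' : #{j | cyclicBlock m j i = true} = m + 1 := by
    rw [← card_filter_val_le m]
    exact Finset.card_equiv (Equiv.subLeft i) (by simp [cyclicBlock])
  simp only [Bool.not_eq_true, h', Finset.card_univ, Fintype.card_fin] at h
  omega

lemma hamming_cyclicBlock_lt (m : ℕ) (j : Fin (2 * m + 1)) :
    hamming (cyclicBlock m j) (onePt _) < hamming (cyclicBlock m j) (zeroPt _) := by
  simp [hamming, onePt, zeroPt, card_cyclicBlock_eq_true, card_cyclicBlock_eq_false]

/-- Mass `p` spread evenly over the cyclic blocks, and the remaining mass at `𝟎`. -/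
noncomputable def blockDist (m : ℕ) (p : ℝ) (X : Fin (2 * m + 1) → Bool) : ℝ :=
  (if zeroPt _ = X then 1 - p else 0) +
    ∑ j, if cyclicBlock m j = X then p / (2 * m + 1) else 0

lemma isDistribution_blockDist {m : ℕ} {p : ℝ} (hp₀ : 0 ≤ p) (hp₁ : p ≤ 1) :
    IsDistribution (blockDist m p) := by
  constructor
  · intro X
    refine add_nonneg ?_ (Finset.sum_nonneg fun j _ => ?_)
    · split_ifs <;> linarith
    · split_ifs <;> positivity
  · unfold blockDist
    rw [Finset.sum_add_distrib, Finset.sum_comm]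
    simp
    field_simp
    ring

open Classical in
lemma wt_blockDist (m : ℕ) (p : ℝ) (S : Set (Fin (2 * m + 1) → Bool)) :
    wt (blockDist m p) S = (if zeroPt _ ∈ S then 1 - p else 0) +
      #{j | cyclicBlock m j ∈ S} * (p / (2 * m + 1)) := by
  have h (Y : Fin (2 * m + 1) → Bool) (a : ℝ) :
      ∑ X ∈ Finset.univ.filter (· ∈ S), (if Y = X then a else 0) = if Y ∈ S then a else 0 := by
    simp
  unfold wt blockDist
  rw [← Finset.sum_filter, Finset.sum_add_distrib, Finset.sum_comm, h]
  simp_rw [h]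
  rw [← Finset.sum_filter, Finset.sum_const, nsmul_eq_mul]

lemma w0_blockDist (m : ℕ) (p : ℝ) (i : Fin (2 * m + 1)) :
    w0 (blockDist m p) i = 1 - p + m * (p / (2 * m + 1)) := by
  classical
  rw [w0, wt_blockDist, if_pos (by simp [zeroPt])]
  congr 3
  convert card_shift_cyclicBlock_eq_false m i
  rfl

lemma le_P1_blockDist {m : ℕ} {p : ℝ} (hp₀ : 0 ≤ p) (hp₁ : p ≤ 1) :
    p ≤ P1 (blockDist m p) (onePt _) (zeroPt _) := by
  refine le_of_eq_of_le ?_ (wt_le_P1 (S := Set.range (cyclicBlock m))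
    (isDistribution_blockDist hp₀ hp₁).1 ?_)
  · have h : zeroPt _ ∉ Set.range (cyclicBlock m) := by
      rintro ⟨j, hj⟩
      have := congrFun hj j
      simp [cyclicBlock, zeroPt] at this
    rw [wt_blockDist, if_neg h]
    simp
    field_simp
  · rintro _ ⟨j, rfl⟩
    exact hamming_cyclicBlock_lt m j

theorem statement_6 (d : ℕ) (hd : Odd d) (hd1 : 1 ≤ d) (c : ℝ)
    (hc1 : (1:ℝ)/2 < c) (hc2 : c < (3:ℝ)/4 - 1/(4*d)) :
    ∃ μ : (Fin d → Bool) → ℝ, IsDistribution μ ∧ (∀ i, w0 μ i = c) ∧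
      ∀ A B : Fin d → Bool, ¬ IsEquilibrium μ A B := by
  obtain ⟨m, rfl⟩ := hd
  have hm : (0 : ℝ) ≤ m := m.cast_nonneg
  obtain ⟨p, hp⟩ : ∃ p : ℝ, p = (2 * m + 1) * (1 - c) / (m + 1) := ⟨_, rfl⟩
  have hp₁ : p ≤ 1 := by
    rw [hp, div_le_one (by positivity)]
    nlinarith
  have hp₂ : 1 / 2 < p := by
    have h : (1 : ℝ) / (4 * (2 * m + 1)) * (2 * m + 1) = 1 / 4 := by field_simp
    push_cast at hc2
    rw [hp, lt_div_iff₀ (by positivity)]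
    nlinarith
  have hp₀ : 0 ≤ p := by linarith
  have hμ := isDistribution_blockDist (m := m) hp₀ hp₁
  have hw (i) : w0 (blockDist m p) i = c := by
    rw [w0_blockDist, hp]
    field_simp
    ring
  exact ⟨blockDist m p, hμ, hw, not_isEquilibrium_of_zeroPt_beaten hμ (fun i => by rwa [hw])
    ⟨_, hp₂.trans_le (le_P1_blockDist hp₀ hp₁)⟩⟩
end
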